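/- For every i ∈ {1,…,n}, every state s ∈ V, and every x ≥ σ_i(s), one has Φ(x, s, i) = x. -/

import Mathlib

open Finset

/-- A single-line Markovian Pandora's box instance with `n` boxes, opened in the fixed
order `0, 1, …, n-1`, and rewards taking values among `v 0 < v 1 < … < v (k-1)`. -/
structure LineInstance (n k : ℕ) : Type where
  n_pos : 0 < n
  k_pos : 0 < k
  /-- the possible reward values -/
  v : Fin k → ℝ
  v_mono : StrictMono v
  v_nonneg : ∀ j, 0 ≤ v j
  /-- opening costs -/
  c : Fin n → ℝ
  c_nonneg : ∀ i, 0 ≤ c i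
  /-- distribution of the reward of the first box -/
  p0 : Fin k → ℝ
  p0_nonneg : ∀ j, 0 ≤ p0 j
  p0_sum : ∑ j, p0 j = 1
  /-- `P i s y`: probability that box `i` has reward value `v y` given that box `i-1`
  had reward value `v s` (used for `1 ≤ i`). -/
  P : ℕ → Fin k → Fin k → ℝ
  P_nonneg : ∀ i s y, 0 ≤ P i s y
  P_sum : ∀ i s, ∑ y, P i s y = 1

namespace LineInstance

variable {n k : ℕ}

/-- Law of the reward of box `i` given that box `i-1` had reward value `v s`
(for `i = 0`, the unconditioned initial law: the conditioning is vacuous). -/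
def step (L : LineInstance n k) (i : ℕ) (s : Fin k) : Fin k → ℝ :=
  if i = 0 then L.p0 else L.P i s

/-- A stopping rule: given the list of reward values observed since the start, decide
whether to stop now (before opening the next box).  Thus the event of stopping after
exactly `m` boxes is determined by the first `m` observed rewards. -/
abbrev Rule (k : ℕ) : Type := List (Fin k) → Bool

/-- Value of the stopping rule `τ` when the next box to open is `i`, the best reward in
hand (outside option) is `x`, the last observed state is `s`, and `hist` is the list of
rewards observed so far.  When `i = n` (no box remains) the value is `x`. -/
noncomputable def ruleVal (L : LineInstance n k) (τ : Rule k)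
    (i : ℕ) (x : ℝ) (s : Fin k) (hist : List (Fin k)) : ℝ :=
  if h : i < n then
    if τ hist then x
    else
      -L.c ⟨i, h⟩ +
        ∑ y : Fin k, L.step i s y * L.ruleVal τ (i + 1) (max x (L.v y)) y (hist ++ [y])
  else x
termination_by n - i
decreasing_by omega

/-- `Φ(x, s, i)`: the optimal value over all stopping rules, when the next box to open is
`i`, the outside option is `x` and the last observed state is `s`. -/
noncomputable def phi (L : LineInstance n k) (x : ℝ) (s : Fin k) (i : ℕ) : ℝ :=
  ⨆ τ : Rule k, L.ruleVal τ i x s []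

/-- the largest possible reward value `v_k` -/
def vmax (L : LineInstance n k) : ℝ := L.v ⟨k - 1, Nat.sub_lt L.k_pos Nat.one_pos⟩

/-- The generalized reservation value `σ_i(s)`: the least `x ∈ [0, v_k]` with
`Φ(x, s, i) = x`. -/
noncomputable def grv (L : LineInstance n k) (s : Fin k) (i : ℕ) : ℝ :=
  sInf {x : ℝ | x ∈ Set.Icc 0 L.vmax ∧ L.phi x s i = x}

end LineInstance

namespace LineInstance

variable {n k : ℕ}

theorem step_nonneg (L : LineInstance n k) (i : ℕ) (s y : Fin k) : 0 ≤ L.step i s y := by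
  unfold step
  split_ifs
  exacts [L.p0_nonneg y, L.P_nonneg i s y]

theorem step_sum (L : LineInstance n k) (i : ℕ) (s : Fin k) : ∑ y, L.step i s y = 1 := by
  unfold step
  split_ifs
  exacts [L.p0_sum, L.P_sum i s]

theorem v_le_vmax (L : LineInstance n k) (y : Fin k) : L.v y ≤ L.vmax :=
  L.v_mono.monotone (Fin.le_def.2 (Nat.le_sub_one_of_lt y.isLt))

theorem vmax_nonneg (L : LineInstance n k) : 0 ≤ L.vmax := L.v_nonneg _

/-- Averaging under `step` preserves pointwise bounds up to an additive constant. -/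
theorem step_average_le_add (L : LineInstance n k) (i : ℕ) (s : Fin k) {f g : Fin k → ℝ} {d : ℝ}
    (h : ∀ y, f y ≤ g y + d) :
    ∑ y, L.step i s y * f y ≤ ∑ y, L.step i s y * g y + d :=
  calc ∑ y, L.step i s y * f y
      ≤ ∑ y, L.step i s y * (g y + d) :=
        sum_le_sum fun y _ => mul_le_mul_of_nonneg_left (h y) (L.step_nonneg i s y)
    _ = ∑ y, L.step i s y * g y + d := by
        simp only [mul_add, sum_add_distrib, ← sum_mul, step_sum, one_mul]

/-- Replacing the outside option `z` by `x` raises the value of a rule by at most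
`max (x - z) 0`. -/
theorem ruleVal_le_add (L : LineInstance n k) (τ : Rule k) (i : ℕ) (s : Fin k)
    (hist : List (Fin k)) {x z d : ℝ} (hd : 0 ≤ d) (hxz : x ≤ z + d) :
    L.ruleVal τ i x s hist ≤ L.ruleVal τ i z s hist + d := by
  induction hm : n - i generalizing i s hist x z with
  | zero =>
    unfold ruleVal
    rw [dif_neg (by omega), dif_neg (by omega)]
    exact hxz
  | succ m ih =>
    unfold ruleVal
    rw [dif_pos (by omega), dif_pos (by omega)]
    split_ifs
    · exact hxz
    · rw [add_assoc]
      gcongr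
      refine L.step_average_le_add i s fun y => ih (i + 1) y _ ?_ (by omega)
      rw [← max_add_add_right]
      exact max_le_max hxz (le_add_of_nonneg_right hd)

theorem ruleVal_le_max (L : LineInstance n k) (τ : Rule k) (i : ℕ) (s : Fin k)
    (hist : List (Fin k)) (x : ℝ) :
    L.ruleVal τ i x s hist ≤ max x L.vmax := by
  induction hm : n - i generalizing i s hist x with
  | zero =>
    unfold ruleVal
    rw [dif_neg (by omega)]
    exact le_max_left _ _
  | succ m ih =>
    unfold ruleVal
    rw [dif_pos (by omega)]
    split_ifs
    · exact le_max_left _ _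
    · have h := L.step_average_le_add i s (g := 0) (d := max x L.vmax) fun y => by
        simpa [max_assoc, L.v_le_vmax y] using
          ih (i + 1) y (hist ++ [y]) (max x (L.v y)) (by omega)
      simp only [Pi.zero_apply, mul_zero, sum_const_zero, zero_add] at h
      linarith [L.c_nonneg ⟨i, by omega⟩]

theorem bddAbove_range_ruleVal (L : LineInstance n k) (x : ℝ) (s : Fin k) (i : ℕ) :
    BddAbove (Set.range fun τ : Rule k => L.ruleVal τ i x s []) :=
  ⟨max x L.vmax, Set.forall_mem_range.2 fun τ => L.ruleVal_le_max τ i s [] x⟩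

/-- Stopping immediately is always available. -/
theorem le_phi (L : LineInstance n k) (x : ℝ) (s : Fin k) (i : ℕ) : x ≤ L.phi x s i := by
  refine le_trans (Eq.ge ?_) (le_ciSup (L.bddAbove_range_ruleVal x s i) fun _ => true)
  unfold ruleVal
  simp

theorem phi_le_max (L : LineInstance n k) (x : ℝ) (s : Fin k) (i : ℕ) :
    L.phi x s i ≤ max x L.vmax :=
  ciSup_le fun τ => L.ruleVal_le_max τ i s [] x

theorem phi_le_add (L : LineInstance n k) (s : Fin k) (i : ℕ) {x z d : ℝ} (hd : 0 ≤ d)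
    (hxz : x ≤ z + d) : L.phi x s i ≤ L.phi z s i + d :=
  ciSup_le fun τ => (L.ruleVal_le_add τ i s [] hd hxz).trans
    (add_le_add_left (le_ciSup (L.bddAbove_range_ruleVal z s i) τ) d)

theorem phi_vmax (L : LineInstance n k) (s : Fin k) (i : ℕ) : L.phi L.vmax s i = L.vmax :=
  le_antisymm ((L.phi_le_max L.vmax s i).trans_eq (max_self _)) (L.le_phi _ s i)

end LineInstance

open LineInstance in
/-- For every box index `i`, state `s`, and every `x ≥ σ_i(s)`, one has `Φ(x, s, i) = x`. -/
theorem phi_eq_self_of_ge_grv {n k : ℕ} (L : LineInstance n k)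
    (i : ℕ) (hi : i < n) (s : Fin k) (x : ℝ) (hx : L.grv s i ≤ x) :
    L.phi x s i = x := by
  refine le_antisymm (le_of_forall_pos_le_add fun ε hε => ?_) (L.le_phi x s i)
  have hne : {z : ℝ | z ∈ Set.Icc 0 L.vmax ∧ L.phi z s i = z}.Nonempty :=
    ⟨L.vmax, ⟨L.vmax_nonneg, le_rfl⟩, L.phi_vmax s i⟩
  obtain ⟨z, ⟨-, hz⟩, hzx⟩ := exists_lt_of_csInf_lt hne (hx.trans_lt (lt_add_of_pos_right x hε))
  have h := L.phi_le_add s i (x := x) (z := z) (d := x + ε - z) (by linarith) (by linarith)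
  linarith
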